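/- Intersection distributes over arbitrary suprema of central soft sets: let (f, A) be a central soft set and {(f_i, A_i) : i ∈ I} a family of central soft sets over a common universe U. Then (f, A) ⊓ Sup_{i ∈ I}(f_i, A_i) = Sup_{i ∈ I} [(f, A) ⊓ (f_i, A_i)], where Sup denotes the supremum of a family {(g_j, B_j) : j ∈ J} given explicitly as (h, ⋃_{j ∈ J} B_j) with h(e) = ⋃_{j ∈ J_e} g_j(e) if J_e = {j ∈ J : e ∈ B_j} ≠ ∅ and h(e) = ⋃_{j ∈ J} g_j(e) otherwise. -/

import Mathlib

open Classical

/-- A central soft set over a universe `U` with parameter set `E`: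
a mapping `f : E → Set U` together with a central set `A ⊆ E`. -/
structure CSS (E U : Type*) where
  f : E → Set U
  A : Set E

/-- Union of central soft sets. -/
noncomputable def cssUnion {E U : Type*} (s t : CSS E U) : CSS E U where
  f := fun e =>
    if e ∈ s.A \ t.A then s.f e
    else if e ∈ t.A \ s.A then t.f e
    else s.f e ∪ t.f e
  A := s.A ∪ t.A

/-- Intersection of central soft sets. -/
noncomputable def cssInter {E U : Type*} (s t : CSS E U) : CSS E U where
  f := fun e =>
    if e ∈ s.A \ t.A then t.f e
    else if e ∈ t.A \ s.A then s.f e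
    else s.f e ∩ t.f e
  A := s.A ∩ t.A

/-- Complement of a central soft set. -/
def cssCompl {E U : Type*} (s : CSS E U) : CSS E U where
  f := fun e => (s.f e)ᶜ
  A := s.Aᶜ

/-- Difference of central soft sets: `s − t = s ⊓ tᶜ`. -/
noncomputable def cssDiff {E U : Type*} (s t : CSS E U) : CSS E U :=
  cssInter s (cssCompl t)

/-- The central soft information order: `s ⊑ t` iff `s ⊔ t = t`. -/
def cssLE {E U : Type*} (s t : CSS E U) : Prop := cssUnion s t = t

/-- Projection of a central soft set over a set `B` of parameters
(the mapping is unchanged, the central set becomes `B`). -/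
def cssProj {E U : Type*} (s : CSS E U) (B : Set E) : CSS E U where
  f := s.f
  A := B

/-- Supremum of a family of central soft sets. -/
noncomputable def cssSup {E U ι : Type*} (F : ι → CSS E U) : CSS E U where
  f := fun e =>
    if {i : ι | e ∈ (F i).A}.Nonempty then ⋃ i ∈ {i : ι | e ∈ (F i).A}, (F i).f e
    else ⋃ i, (F i).f e
  A := ⋃ i, (F i).A

theorem stmt16 {E U ι : Type*} (s : CSS E U) (F : ι → CSS E U) :
    cssInter s (cssSup F) = cssSup (fun i => cssInter s (F i)) := by
  have hA : s.A ∩ ⋃ i, (F i).A = ⋃ i, s.A ∩ (F i).A := Set.inter_iUnion _ _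
  unfold cssInter cssSup
  simp only [CSS.mk.injEq]
  refine ⟨?_, hA⟩
  funext e
  ext x
  by_cases hs : e ∈ s.A <;> by_cases hF : ∃ i, e ∈ (F i).A
  · have hF' : {i | e ∈ (F i).A}.Nonempty := hF
    simp only [hs, hF, hF', Set.mem_sdiff, Set.mem_iUnion, Set.mem_inter_iff, Set.mem_ofPred_eq,
      true_and, not_true_eq_false, and_false, if_true, if_false]
    simp only [exists_prop]
    grind
  · have hF' : ¬ {i | e ∈ (F i).A}.Nonempty := hF
    have hF'' : ∀ i, e ∉ (F i).A := not_exists.mp hF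
    simp [hs, hF'']
  · have hF' : {i | e ∈ (F i).A}.Nonempty := hF
    obtain ⟨j, hj⟩ := hF
    simp only [hs, hF', Set.mem_sdiff, Set.mem_iUnion, Set.mem_inter_iff, Set.mem_ofPred_eq,
      false_and, not_false_eq_true, and_true, Set.ofPred_false, Set.not_nonempty_empty,
      if_true, if_false, show (∃ i, e ∈ (F i).A) from ⟨j, hj⟩]
    constructor
    · exact fun hx => ⟨j, by simpa [hj] using hx⟩
    · rintro ⟨i, hi⟩
      split_ifs at hi
      exacts [hi, hi.1]
  · have hF'' : ∀ i, e ∉ (F i).A := not_exists.mp hF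
    simp [hs, hF'']
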